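/- Let M₁ and M₂ be countable elementary submodels of H_{ω₂}, let δ := sup(M₁ ∩ M₂ ∩ Ord), and suppose every countable subset of δ that is an element of M₁ is also an element of M₂. Then M₁ ∩ M₂ ∩ Ord = M₁ ∩ δ ∩ Ord, i.e., the ordinals of M₁ ∩ M₂ form an initial segment of the ordinals of M₁. -/

import Mathlib

open FirstOrder

/-- The language with a single binary relation symbol (membership). -/
inductive memRel : ℕ → Type
  | mem : memRel 2

/-- The language of set theory: one binary relation `∈`. -/
def memLang : Language := ⟨fun _ => Empty, memRel⟩

/-- `H κ` is the collection of sets of hereditary cardinality `< κ`. -/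
def HSet (κ : Cardinal.{0}) : Set ZFSet.{0} :=
  {x | ZFSet.Hereditarily (fun y => Cardinal.mk y.toSet < Cardinal.lift.{1} κ) x}

/-- `H κ` as a structure in the language of set theory. -/
noncomputable instance HSetStructure (κ : Cardinal.{0}) : memLang.Structure (HSet κ) where
  funMap {_n} f := Empty.elim f
  RelMap {_n} r := memRel.rec (motive := fun n _ => (Fin n → HSet κ) → Prop)
    (fun v => (v 0).1 ∈ (v 1).1) r

/-- The set of ordinals of a submodel `M`, identified via von Neumann rank. -/
def ordTrace {κ : Cardinal.{0}} (M : Set (HSet κ)) : Set Ordinal.{0} :=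
  {o | ∃ x : HSet κ, x ∈ M ∧ x.1.IsOrdinal ∧ x.1.rank = o}

/-- The atomic formula `s ∈ t`. -/
def memFormula {α : Type} {n : ℕ} (s t : memLang.Term (α ⊕ Fin n)) : memLang.BoundedFormula α n :=
  Language.Relations.boundedFormula₂ (L := memLang) memRel.mem s t

theorem realize_memFormula {κ : Cardinal.{0}} {α : Type} {n : ℕ}
    (s t : memLang.Term (α ⊕ Fin n)) (v : α → HSet κ) (xs : Fin n → HSet κ) :
    (memFormula s t).Realize v xs ↔
      (s.realize (Sum.elim v xs)).1 ∈ (t.realize (Sum.elim v xs)).1 :=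
  Language.BoundedFormula.realize_rel₂

theorem HSet.mem_of_mem {κ : Cardinal.{0}} {x y : ZFSet.{0}} (hx : x ∈ HSet κ) (hy : y ∈ x) :
    y ∈ HSet κ :=
  ZFSet.Hereditarily.mem hx hy

theorem HSet.ext {κ : Cardinal.{0}} {x y : HSet κ} (h : ∀ z : HSet κ, z.1 ∈ x.1 ↔ z.1 ∈ y.1) :
    x = y :=
  Subtype.ext <| ZFSet.ext fun z =>
    ⟨fun hz => (h ⟨z, mem_of_mem x.2 hz⟩).1 hz, fun hz => (h ⟨z, mem_of_mem y.2 hz⟩).2 hz⟩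

theorem HSet.insert_mem {κ : Cardinal.{0}} (hκ : Cardinal.aleph0 ≤ κ) {x y : ZFSet.{0}}
    (hx : x ∈ HSet κ) (hy : y ∈ HSet κ) : insert x y ∈ HSet κ := by
  refine ZFSet.hereditarily_iff.2 ⟨?_, fun z hz => ?_⟩
  · have h : (insert x y : ZFSet.{0}).toSet = insert x y.toSet := by
      ext z
      exact ZFSet.mem_insert_iff
    rw [h]
    refine Cardinal.mk_insert_le.trans_lt (Cardinal.add_lt_of_lt ?_ hy.self ?_)
    · exact Cardinal.aleph0_le_lift.2 hκ
    · exact Cardinal.one_lt_aleph0.trans_le (Cardinal.aleph0_le_lift.2 hκ)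
  · rcases ZFSet.mem_insert_iff.1 hz with rfl | hz
    exacts [hx, mem_of_mem hy hz]

theorem Ordinal.mk_toSet_toZFSet (o : Ordinal.{0}) :
    Cardinal.mk o.toZFSet.toSet = Cardinal.lift.{1} o.card := by
  have h : o.toZFSet.toSet = Ordinal.toZFSet '' Set.Iio o := Ordinal.coe_toZFSet
  rw [h, Cardinal.mk_image_eq Ordinal.toZFSet_injective, Cardinal.mk_Iio_ordinal]

theorem HSet.toZFSet_mem {κ : Cardinal.{0}} (o : Ordinal.{0}) (ho : o.card < κ) :
    o.toZFSet ∈ HSet κ := by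
  induction o using WellFoundedLT.induction with
  | ind o ih =>
    refine ZFSet.hereditarily_iff.2 ⟨?_, fun y hy => ?_⟩
    · rw [Ordinal.mk_toSet_toZFSet]
      exact Cardinal.lift_lt.2 ho
    · obtain ⟨a, ha, rfl⟩ := Ordinal.mem_toZFSet_iff.1 hy
      exact ih a ha ((Ordinal.card_le_card ha.le).trans_lt ho)

theorem Ordinal.mem_toZFSet_omega0_iff {x : ZFSet.{0}} :
    x ∈ Ordinal.omega0.toZFSet ↔
      x = ∅ ∨ ∃ y ∈ Ordinal.omega0.toZFSet, x = insert y y := by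
  simp only [Ordinal.mem_toZFSet_iff, Ordinal.lt_omega0]
  constructor
  · rintro ⟨_, ⟨n, rfl⟩, rfl⟩
    cases n with
    | zero => simp
    | succ n => exact .inr ⟨_, ⟨_, ⟨n, rfl⟩, rfl⟩, by rw [Nat.cast_succ, Ordinal.toZFSet_add_one]⟩
  · rintro (rfl | ⟨_, ⟨_, ⟨n, rfl⟩, rfl⟩, rfl⟩)
    · exact ⟨0, ⟨0, by simp⟩, by simp⟩
    · exact ⟨_, ⟨n + 1, rfl⟩, by rw [Nat.cast_succ, Ordinal.toZFSet_add_one]⟩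

namespace FirstOrder.Language.ElementarySubstructure

/-- An elementary substructure contains every element definable with parameters in it. -/
theorem mem_of_unique_realize {L : Language} {N : Type*} [L.Structure N]
    (M : L.ElementarySubstructure N) {α : Type*} (φ : L.BoundedFormula α 1) (v : α → N)
    (hv : ∀ a, v a ∈ M) (x : N) (hx : φ.Realize v (Fin.snoc default x))
    (huniq : ∀ y, φ.Realize v (Fin.snoc default y) → y = x) : x ∈ M := by
  let w : α → M := fun a => ⟨v a, hv a⟩
  have hw : M.subtype ∘ w = v := rfl
  have h : φ.ex.Realize w (default : Fin 0 → M) := by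
    rw [← M.subtype.map_boundedFormula, hw, BoundedFormula.realize_ex]
    exact ⟨x, hx⟩
  obtain ⟨y, hy⟩ := BoundedFormula.realize_ex.1 h
  rw [← M.subtype.map_boundedFormula, hw, Fin.comp_snoc] at hy
  have hyx : (y : N) = x := huniq _ (by rwa [Subsingleton.elim default (M.subtype ∘ default)])
  exact hyx ▸ y.2

variable {κ : Cardinal.{0}} (M : memLang.ElementarySubstructure (HSet κ))

theorem mem_of_eq_empty (x : HSet κ) (hx : x.1 = ∅) : x ∈ M := by
  let φ : memLang.BoundedFormula Empty 1 := ∀' ∼(memFormula (&1) (&0))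
  have key (y : HSet κ) : φ.Realize (Empty.elim : Empty → HSet κ) (Fin.snoc default y) ↔
      ∀ z : HSet κ, z.1 ∉ y.1 := by
    simp [φ, realize_memFormula, Fin.snoc]
  refine M.mem_of_unique_realize φ _ (fun a => a.elim) x ((key x).2 fun z => ?_) fun y hy => ?_
  · simp [hx]
  · exact HSet.ext fun z => by simp [hx, (key y).1 hy z]

theorem mem_of_eq_insert {x y z : HSet κ} (hx : x ∈ M) (hy : y ∈ M)
    (hz : z.1 = insert x.1 y.1) : z ∈ M := by
  let φ : memLang.BoundedFormula (Fin 2) 1 :=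
    ∀' ((memFormula (&1) (&0)).iff
      (Term.bdEqual (&1) (Term.var (Sum.inl 0)) ⊔ memFormula (&1) (Term.var (Sum.inl 1))))
  have key (u : HSet κ) : φ.Realize ![x, y] (Fin.snoc default u) ↔
      ∀ t : HSet κ, t.1 ∈ u.1 ↔ t = x ∨ t.1 ∈ y.1 := by
    simp [φ, realize_memFormula, Fin.snoc]
  have hmem (t : HSet κ) : t.1 ∈ z.1 ↔ t = x ∨ t.1 ∈ y.1 := by
    rw [hz, ZFSet.mem_insert_iff, Subtype.ext_iff]
  refine M.mem_of_unique_realize φ _ (Fin.forall_fin_two.2 ⟨hx, hy⟩) z ((key z).2 hmem)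
    fun u hu => HSet.ext fun t => ?_
  rw [(key u).1 hu, hmem]

theorem mem_of_eq_insert_of_notMem {x y z : HSet κ} (hy : y ∈ M) (hz : z ∈ M)
    (hzxy : z.1 = insert x.1 y.1) (hxy : x.1 ∉ y.1) : x ∈ M := by
  let φ : memLang.BoundedFormula (Fin 2) 1 :=
    memFormula (&0) (Term.var (Sum.inl 0)) ⊓ ∼(memFormula (&0) (Term.var (Sum.inl 1)))
  have key (u : HSet κ) : φ.Realize ![z, y] (Fin.snoc default u) ↔
      u.1 ∈ z.1 ∧ u.1 ∉ y.1 := by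
    simp [φ, realize_memFormula, Fin.snoc]
  refine M.mem_of_unique_realize φ _ (Fin.forall_fin_two.2 ⟨hz, hy⟩) x ((key x).2 ?_)
    fun u hu => ?_
  · simp [hzxy, hxy]
  · obtain ⟨h, h'⟩ := (key u).1 hu
    rw [hzxy, ZFSet.mem_insert_iff] at h
    exact Subtype.ext (h.resolve_right h')

theorem mem_of_eq_toZFSet_nat (hκ : Cardinal.aleph0 ≤ κ) (n : ℕ) (x : HSet κ)
    (hx : x.1 = (n : Ordinal.{0}).toZFSet) : x ∈ M := by
  induction n generalizing x with
  | zero => exact M.mem_of_eq_empty x (by simpa using hx)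
  | succ n ih =>
    let y : HSet κ := ⟨(n : Ordinal.{0}).toZFSet,
      HSet.toZFSet_mem _ (by simpa using (Cardinal.natCast_lt_aleph0 (n := n)).trans_le hκ)⟩
    refine M.mem_of_eq_insert (ih y rfl) (ih y rfl) ?_
    rw [hx, Nat.cast_succ, Ordinal.toZFSet_add_one]

theorem mem_of_eq_toZFSet_omega0 (x : HSet κ) (hx : x.1 = Ordinal.omega0.toZFSet) : x ∈ M := by
  let φ : memLang.BoundedFormula Empty 1 :=
    ∀' ((memFormula (&1) (&0)).iff ((∀' ∼(memFormula (&2) (&1))) ⊔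
      ∃' (memFormula (&2) (&0) ⊓ ∀' ((memFormula (&3) (&1)).iff
        (Term.bdEqual (&3) (&2) ⊔ memFormula (&3) (&2))))))
  have key (u : HSet κ) : φ.Realize (Empty.elim : Empty → HSet κ) (Fin.snoc default u) ↔
      ∀ z : HSet κ, z.1 ∈ u.1 ↔ z.1 = ∅ ∨ ∃ y ∈ u.1, z.1 = insert y y := by
    have hempty (z : HSet κ) : z.1 = ∅ ↔ ∀ t : HSet κ, t.1 ∉ z.1 := by
      rw [ZFSet.eq_empty]
      exact ⟨fun h t => h t, fun h t ht => h ⟨t, HSet.mem_of_mem z.2 ht⟩ ht⟩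
    have hsucc (z : HSet κ) : (∃ y ∈ u.1, z.1 = insert y y) ↔
        ∃ y : HSet κ, y.1 ∈ u.1 ∧ ∀ t : HSet κ, t.1 ∈ z.1 ↔ t = y ∨ t.1 ∈ y.1 := by
      constructor
      · rintro ⟨y, hy, hz⟩
        refine ⟨⟨y, HSet.mem_of_mem u.2 hy⟩, hy, fun t => ?_⟩
        rw [hz, ZFSet.mem_insert_iff, Subtype.ext_iff]
      · rintro ⟨y, hy, hz⟩
        refine ⟨y, hy, ZFSet.ext fun t => ?_⟩
        rw [ZFSet.mem_insert_iff]
        constructor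
        · intro ht
          simpa [Subtype.ext_iff] using (hz ⟨t, HSet.mem_of_mem z.2 ht⟩).1 ht
        · rintro (rfl | ht)
          · exact (hz y).2 (.inl rfl)
          · exact (hz ⟨t, HSet.mem_of_mem y.2 ht⟩).2 (.inr ht)
    simp only [hempty, hsucc]
    simp [φ, realize_memFormula, Fin.snoc]
  refine M.mem_of_unique_realize φ _ (fun a => a.elim) x ((key x).2 fun z => ?_) fun u hu => ?_
  · rw [hx]
    exact Ordinal.mem_toZFSet_omega0_iff
  · rw [key] at hu
    have huω (z : ZFSet.{0}) : z ∈ HSet κ → (z ∈ u.1 ↔ z ∈ Ordinal.omega0.toZFSet) := by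
      induction z using ZFSet.inductionOn with
      | _ z ih =>
        intro hz
        rw [hu ⟨z, hz⟩, Ordinal.mem_toZFSet_omega0_iff]
        refine or_congr_right (exists_congr fun y => and_congr_left fun h => ?_)
        have hy : y ∈ z := by simp [show z = insert y y from h]
        exact ih y hy (HSet.mem_of_mem hz hy)
    exact HSet.ext fun z => by rw [huω z z.2, hx]

end FirstOrder.Language.ElementarySubstructure

theorem toZFSet_nat_mem_ordTrace {κ : Cardinal.{0}} (hκ : Cardinal.aleph0 ≤ κ)
    (M : memLang.ElementarySubstructure (HSet κ)) (n : ℕ) :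
    (n : Ordinal.{0}) ∈ ordTrace (M : Set (HSet κ)) :=
  ⟨⟨_, HSet.toZFSet_mem _ (by simpa using (Cardinal.natCast_lt_aleph0 (n := n)).trans_le hκ)⟩,
    M.mem_of_eq_toZFSet_nat hκ n _ rfl, ZFSet.isOrdinal_toZFSet _, Ordinal.rank_toZFSet _⟩

theorem succ_mem_ordTrace {κ : Cardinal.{0}} (hκ : Cardinal.aleph0 ≤ κ)
    (M : memLang.ElementarySubstructure (HSet κ)) {o : Ordinal.{0}}
    (ho : o ∈ ordTrace (M : Set (HSet κ))) : Order.succ o ∈ ordTrace (M : Set (HSet κ)) := by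
  obtain ⟨x, hxM, hx, rfl⟩ := ho
  exact ⟨⟨insert x.1 x.1, HSet.insert_mem hκ x.2 x.2⟩, M.mem_of_eq_insert hxM hxM rfl,
    ZFSet.isOrdinal_succ hx, by simp⟩

/-- Let `M₁, M₂ ≺ H_{ω₂}` be countable, `δ := sup(M₁ ∩ M₂ ∩ Ord)`, and
suppose every countably infinite subset of `δ` lying in `M₁` also lies in `M₂`.  Then the
ordinals of `M₁ ∩ M₂` form an initial segment of the ordinals of `M₁`. -/
theorem inter_ordinals_initial_segment
    (M₁ M₂ : memLang.ElementarySubstructure (HSet (Cardinal.aleph 2)))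
    (hM₁ : (M₁ : Set (HSet (Cardinal.aleph 2))).Countable)
    (hM₂ : (M₂ : Set (HSet (Cardinal.aleph 2))).Countable)
    (δ : Ordinal)
    (hδ : δ = sSup (ordTrace (M₁ : Set (HSet (Cardinal.aleph 2))) ∩
      ordTrace (M₂ : Set (HSet (Cardinal.aleph 2)))))
    (hsub : ∀ A : HSet (Cardinal.aleph 2), A ∈ M₁ →
      Cardinal.mk A.1.toSet = Cardinal.aleph0 →
      (∀ y ∈ A.1, y.IsOrdinal ∧ y.rank < δ) → A ∈ M₂) :
    ordTrace (M₁ : Set (HSet (Cardinal.aleph 2))) ∩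
        ordTrace (M₂ : Set (HSet (Cardinal.aleph 2))) =
      ordTrace (M₁ : Set (HSet (Cardinal.aleph 2))) ∩ Set.Iio δ := by
  have hκ : Cardinal.aleph0 < Cardinal.aleph 2 := by
    rw [← Cardinal.aleph_zero]
    exact Cardinal.aleph_lt_aleph.2 (by norm_num)
  set S := ordTrace (M₁ : Set (HSet (Cardinal.aleph 2))) ∩
    ordTrace (M₂ : Set (HSet (Cardinal.aleph 2)))
  have hcount : S.Countable := by
    refine (hM₁.image fun x => x.1.rank).mono ?_
    rintro _ ⟨⟨x, hx, -, rfl⟩, -⟩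
    exact ⟨x, hx, rfl⟩
  have hbdd : BddAbove S :=
    have := hcount.to_subtype
    Ordinal.bddAbove_of_small
  have hlt {o : Ordinal} (ho : o ∈ S) : o < δ :=
    hδ ▸ (Order.lt_succ o).trans_le
      (le_csSup hbdd ⟨succ_mem_ordTrace hκ.le M₁ ho.1, succ_mem_ordTrace hκ.le M₂ ho.2⟩)
  refine Set.Subset.antisymm (fun o ho => ⟨ho.1, hlt ho⟩) ?_
  rintro _ ⟨⟨β, hβM₁, hβ, rfl⟩, hβδ⟩
  refine ⟨⟨β, hβM₁, hβ, rfl⟩, β, ?_, hβ, rfl⟩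
  let w : HSet (Cardinal.aleph 2) :=
    ⟨Ordinal.omega0.toZFSet, HSet.toZFSet_mem _ (by simp)⟩
  by_cases hβω : β.1 ∈ w.1
  · obtain ⟨a, ha, haβ⟩ := Ordinal.mem_toZFSet_iff.1 hβω
    obtain ⟨n, rfl⟩ := Ordinal.lt_omega0.1 ha
    exact M₂.mem_of_eq_toZFSet_nat hκ.le n β haβ.symm
  let A : HSet (Cardinal.aleph 2) := ⟨insert β.1 w.1, HSet.insert_mem hκ.le β.2 w.2⟩
  have hAM₁ : A ∈ M₁ := M₁.mem_of_eq_insert hβM₁ (M₁.mem_of_eq_toZFSet_omega0 w rfl) rfl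
  have hAcard : Cardinal.mk A.1.toSet = Cardinal.aleph0 := by
    have h : A.1.toSet = insert β.1 w.1.toSet := by
      ext z
      exact ZFSet.mem_insert_iff
    rw [h, Cardinal.mk_insert (s := w.1.toSet) hβω, Ordinal.mk_toSet_toZFSet]
    simp
  have hAδ : ∀ y ∈ A.1, y.IsOrdinal ∧ y.rank < δ := by
    intro y hy
    rcases ZFSet.mem_insert_iff.1 hy with rfl | hy
    · exact ⟨hβ, hβδ⟩
    · obtain ⟨a, ha, rfl⟩ := Ordinal.mem_toZFSet_iff.1 hy
      obtain ⟨n, rfl⟩ := Ordinal.lt_omega0.1 ha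
      refine ⟨ZFSet.isOrdinal_toZFSet _, ?_⟩
      rw [Ordinal.rank_toZFSet]
      exact hlt ⟨toZFSet_nat_mem_ordTrace hκ.le M₁ n, toZFSet_nat_mem_ordTrace hκ.le M₂ n⟩
  exact M₂.mem_of_eq_insert_of_notMem (M₂.mem_of_eq_toZFSet_omega0 w rfl)
    (hsub A hAM₁ hAcard hAδ) rfl hβω
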